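/- With the Section-4 setup, ⟨t₁, t₂, t₃, t₄⟩ = G, where G = ⟨H, t⟩ with H = {block-diag(A, (Aᵀ)⁻¹) : A ∈ SL₃(GF(p))} and t = [[0, I₃],[I₃, 0]]; moreover ⟨t₂, t₃⟩ = ⟨t₁, t₂, t₃⟩ ∩ ⟨t₂, t₃, t₄⟩ = C_G(t) ∩ C_G(r). -/

import Mathlib

open Matrix

open scoped MatrixGroups

/-- An additively parametrized subset of a group meets a subgroup in everything or trivially when
the parameters form a prime field. -/
theorem mem_of_map_add_mul {p : ℕ} [Fact p.Prime] {Γ : Type*} [Group Γ] (K : Subgroup Γ)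
    (f : ZMod p → Γ) (hf : ∀ a b, f (a + b) = f a * f b) {k : ZMod p} (hk : k ≠ 0)
    (hfk : f k ∈ K) (a : ZMod p) : f a ∈ K := by
  have h0 : f 0 = 1 := by simpa using hf 0 0
  have hn : ∀ n : ℕ, f (n * k) ∈ K := by
    intro n
    induction n with
    | zero => simp [h0]
    | succ n ih =>
      rw [Nat.cast_succ, add_mul, one_mul, hf]
      exact K.mul_mem ih hfk
  have := hn (a / k).val
  rwa [ZMod.natCast_zmod_val, div_mul_cancel₀ _ hk] at this

section Generation

variable {F : Type*} [Field F]

/-- The one-parameter group of regular unipotent upper triangular matrices preserving the form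
`2 x₀ x₂ - x₁²`. -/
def orthUpper (k : F) : SL(3, F) :=
  ⟨!![1, 2 * k, 2 * k ^ 2; 0, 1, 2 * k; 0, 0, 1], by simp [det_fin_three]⟩

/-- The transposes of the matrices `orthUpper k`. -/
def orthLower (k : F) : SL(3, F) :=
  ⟨!![1, 0, 0; 2 * k, 1, 0; 2 * k ^ 2, 2 * k, 1], by simp [det_fin_three]⟩

/-- A matrix of determinant one as an element of `SL₃`. -/
def mkSL (A : Matrix (Fin 3) (Fin 3) F) (h : A.det = 1) : SL(3, F) := ⟨A, h⟩

theorem coe_mkSL (A : Matrix (Fin 3) (Fin 3) F) (h : A.det = 1) :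
    (mkSL A h : Matrix (Fin 3) (Fin 3) F) = A := rfl

theorem eq_of_coe_eq {A B : SL(3, F)}
    (h : (A : Matrix (Fin 3) (Fin 3) F) = B) : A = B := Subtype.ext h

/-- The elementary matrix `1 + c E_{ij}` in `SL₃` for `i ≠ j`, and the identity for `i = j`. -/
def elem (i j : Fin 3) (c : F) : SL(3, F) :=
  if h : i ≠ j then Matrix.SpecialLinearGroup.transvection h c else 1

/-- The Weyl element exchanging the first and last coordinates. -/
def weylElem (F : Type*) [Field F] : SL(3, F) :=
  ⟨!![0, 0, 1; 0, 1, 0; -1, 0, 0], by simp [det_fin_three]⟩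

theorem coe_orthUpper (k : F) :
    (orthUpper k : Matrix (Fin 3) (Fin 3) F) = !![1, 2 * k, 2 * k ^ 2; 0, 1, 2 * k; 0, 0, 1] := rfl

theorem coe_orthLower (k : F) :
    (orthLower k : Matrix (Fin 3) (Fin 3) F) = !![1, 0, 0; 2 * k, 1, 0; 2 * k ^ 2, 2 * k, 1] := rfl

theorem coe_weylElem : (weylElem F : Matrix (Fin 3) (Fin 3) F) = !![0, 0, 1; 0, 1, 0; -1, 0, 0] :=
  rfl

theorem coe_elem {i j : Fin 3} (h : i ≠ j) (c : F) :
    (elem i j c : Matrix (Fin 3) (Fin 3) F) = 1 + single i j c := by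
  rw [elem, dif_pos h]
  rfl

theorem orthUpper_add (a b : F) : orthUpper (a + b) = orthUpper a * orthUpper b := by
  apply eq_of_coe_eq
  simp only [Matrix.SpecialLinearGroup.coe_mul, coe_orthUpper, mul_fin_three]
  ext i j
  fin_cases i <;> fin_cases j <;> simp <;> ring

theorem orthLower_add (a b : F) : orthLower (a + b) = orthLower a * orthLower b := by
  apply eq_of_coe_eq
  simp only [Matrix.SpecialLinearGroup.coe_mul, coe_orthLower, mul_fin_three]
  ext i j
  fin_cases i <;> fin_cases j <;> simp <;> ring

theorem elem_add (i j : Fin 3) (a b : F) : elem i j (a + b) = elem i j a * elem i j b := by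
  by_cases h : i ≠ j
  · simp only [elem, dif_pos h]
    exact Subtype.ext (transvection_mul_transvection_same (i := i) (j := j) h a b).symm
  · simp only [elem, dif_neg h, one_mul]

theorem elem_zero (i j : Fin 3) : elem i j (0 : F) = 1 := by
  simpa using elem_add i j (0 : F) 0

theorem elem_inv (i j : Fin 3) (a : F) : (elem i j a)⁻¹ = elem i j (-a) := by
  rw [inv_eq_iff_mul_eq_one, ← elem_add, add_neg_cancel, elem_zero]

theorem coe_elem_eq :
    (∀ c : F, (elem 0 1 c : Matrix (Fin 3) (Fin 3) F) = !![1, c, 0; 0, 1, 0; 0, 0, 1]) ∧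
    (∀ c : F, (elem 0 2 c : Matrix (Fin 3) (Fin 3) F) = !![1, 0, c; 0, 1, 0; 0, 0, 1]) ∧
    (∀ c : F, (elem 1 2 c : Matrix (Fin 3) (Fin 3) F) = !![1, 0, 0; 0, 1, c; 0, 0, 1]) ∧
    (∀ c : F, (elem 1 0 c : Matrix (Fin 3) (Fin 3) F) = !![1, 0, 0; c, 1, 0; 0, 0, 1]) ∧
    (∀ c : F, (elem 2 0 c : Matrix (Fin 3) (Fin 3) F) = !![1, 0, 0; 0, 1, 0; c, 0, 1]) ∧
    (∀ c : F, (elem 2 1 c : Matrix (Fin 3) (Fin 3) F) = !![1, 0, 0; 0, 1, 0; 0, c, 1]) := by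
  refine ⟨?_, ?_, ?_, ?_, ?_, ?_⟩ <;> intro c <;> rw [coe_elem (by decide)] <;> ext i j <;>
    fin_cases i <;> fin_cases j <;> simp

/-- A product of four root elements is `diag (4, 1, 1/4)`, which normalizes the highest root
group. -/
theorem torus_mul_elem (h2 : (2 : F) ≠ 0) (c : F) :
    orthUpper 1 * orthLower 2⁻¹ * orthUpper (-2⁻¹) * orthLower (-1) * elem 0 2 c =
      elem 0 2 (16 * c) * (orthUpper 1 * orthLower 2⁻¹ * orthUpper (-2⁻¹) * orthLower (-1)) := by
  apply eq_of_coe_eq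
  simp only [Matrix.SpecialLinearGroup.coe_mul, coe_orthLower, coe_orthUpper, coe_elem_eq,
    mul_fin_three]
  ext i j
  fin_cases i <;> fin_cases j <;> simp <;> field_simp <;> ring_nf <;> simp

theorem orthUpper_mul_orthLower_mul_orthUpper (h2 : (2 : F) ≠ 0) :
    orthUpper (1 : F) * orthLower (-2⁻¹) * orthUpper 1 =
      mkSL !![0, 0, 2; 0, -1, 0; 2⁻¹, 0, 0] (by simp [det_fin_three, h2]) := by
  apply eq_of_coe_eq
  simp only [Matrix.SpecialLinearGroup.coe_mul, coe_mkSL, coe_orthLower, coe_orthUpper,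
    mul_fin_three]
  ext i j
  fin_cases i <;> fin_cases j <;> simp <;> field_simp <;> ring

/-- Conjugation by the orthogonal Weyl element exchanges the highest and lowest root groups. -/
theorem orthWeyl_mul_elem (h2 : (2 : F) ≠ 0) (c : F) :
    orthUpper 1 * orthLower (-2⁻¹) * orthUpper 1 * elem 0 2 (4 * c) =
      elem 2 0 c * (orthUpper 1 * orthLower (-2⁻¹) * orthUpper 1) := by
  rw [orthUpper_mul_orthLower_mul_orthUpper h2]
  apply eq_of_coe_eq
  simp only [Matrix.SpecialLinearGroup.coe_mul, coe_mkSL, coe_elem_eq,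
    mul_fin_three]
  ext i j
  fin_cases i <;> fin_cases j <;> simp <;> field_simp <;> ring

theorem weylElem_eq : weylElem F = elem 0 2 1 * elem 2 0 (-1) * elem 0 2 1 := by
  apply eq_of_coe_eq
  simp only [Matrix.SpecialLinearGroup.coe_mul, coe_elem_eq, coe_weylElem,
    mul_fin_three]
  ext i j
  fin_cases i <;> fin_cases j <;> simp

theorem weylElem_mul_orthUpper_eq_elem_one_zero (k : F) :
    weylElem F * orthUpper k =
      elem 1 0 (4 * k) * (elem 2 0 (-4 * k ^ 2) * orthLower (-k) * weylElem F) := by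
  apply eq_of_coe_eq
  simp only [Matrix.SpecialLinearGroup.coe_mul, coe_orthLower, coe_orthUpper, coe_elem_eq,
    coe_weylElem, mul_fin_three]
  ext i j
  fin_cases i <;> fin_cases j <;> simp <;> ring

theorem weylElem_mul_orthUpper_eq_elem_two_one (k : F) :
    weylElem F * orthUpper k =
      elem 2 1 (-4 * k) * (elem 2 0 (4 * k ^ 2) * orthLower k * weylElem F) := by
  apply eq_of_coe_eq
  simp only [Matrix.SpecialLinearGroup.coe_mul, coe_orthLower, coe_orthUpper, coe_elem_eq,
    coe_weylElem, mul_fin_three]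
  ext i j
  fin_cases i <;> fin_cases j <;> simp <;> ring

theorem weylElem_mul_elem_one_zero (c : F) :
    weylElem F * elem 1 0 (-c) = elem 1 2 c * weylElem F := by
  apply eq_of_coe_eq
  simp only [Matrix.SpecialLinearGroup.coe_mul, coe_elem_eq, coe_weylElem,
    mul_fin_three]
  ext i j
  fin_cases i <;> fin_cases j <;> simp

theorem weylElem_mul_elem_two_one (c : F) :
    weylElem F * elem 2 1 c = elem 0 1 c * weylElem F := by
  apply eq_of_coe_eq
  simp only [Matrix.SpecialLinearGroup.coe_mul, coe_elem_eq, coe_weylElem,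
    mul_fin_three]
  ext i j
  fin_cases i <;> fin_cases j <;> simp

/-- The elementary matrices generate `SL₃`. -/
theorem eq_top_of_elem_mem (K : Subgroup SL(3, F))
    (hK : ∀ (i j : Fin 3) (c : F), i ≠ j → elem i j c ∈ K) : K = ⊤ := by
  rw [eq_top_iff]
  intro A _
  suffices h : ∃ h : A.1.det = 1, mkSL A.1 h ∈ K from h.2
  refine diagonal_transvection_induction (fun M ↦ ∃ h : M.det = 1, mkSL M h ∈ K) A.1 ?_ ?_ ?_
  · intro D hD
    rw [A.2] at hD
    refine ⟨hD, ?_⟩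
    rw [det_diagonal, Fin.prod_univ_three] at hD
    have h0 : D 0 ≠ 0 := by rintro h; simp [h] at hD
    have h1 : D 1 ≠ 0 := by rintro h; simp [h] at hD
    have h2 : D 2 = (D 0)⁻¹ * (D 1)⁻¹ := by field_simp; linear_combination hD
    have key : mkSL (diagonal D) (by rw [det_diagonal, Fin.prod_univ_three, hD]) =
        (elem 0 1 (D 0) * elem 1 0 (-(D 0)⁻¹) * elem 0 1 (D 0) *
          (elem 0 1 (-1) * elem 1 0 1 * elem 0 1 (-1))) *
        (elem 1 2 (D 0 * D 1) * elem 2 1 (-(D 0 * D 1)⁻¹) * elem 1 2 (D 0 * D 1) *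
          (elem 1 2 (-1) * elem 2 1 1 * elem 1 2 (-1))) := by
      apply eq_of_coe_eq
      simp only [Matrix.SpecialLinearGroup.coe_mul, coe_mkSL, coe_elem_eq,
        mul_fin_three]
      ext i j
      fin_cases i <;> fin_cases j <;> simp [h2] <;> field_simp <;> ring_nf <;> simp
    rw [key]
    have hK' (i j : Fin 3) (h : i ≠ j) (c d e : F) : elem i j c * elem j i d * elem i j e ∈ K :=
      K.mul_mem (K.mul_mem (hK _ _ _ h) (hK _ _ _ h.symm)) (hK _ _ _ h)
    exact K.mul_mem
      (K.mul_mem (hK' 0 1 (by decide) _ _ _) (hK' 0 1 (by decide) _ _ _))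
      (K.mul_mem (hK' 1 2 (by decide) _ _ _) (hK' 1 2 (by decide) _ _ _))
  · rintro ⟨i, j, h, c⟩
    refine ⟨det_transvection_of_ne i j h c, ?_⟩
    convert hK i j c h
    exact eq_of_coe_eq (coe_elem h c).symm
  · rintro M N ⟨hM, hM'⟩ ⟨hN, hN'⟩
    exact ⟨by rw [det_mul, hM, hN, one_mul], K.mul_mem hM' hN'⟩

end Generation

/-- Two orthogonal groups of plane conics sharing a regular unipotent subgroup, but distinct,
generate `SL₃` over the prime field. -/
theorem eq_top_of_orthUpper_mem {p : ℕ} [Fact p.Prime] (h2 : (2 : ZMod p) ≠ 0)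
    (h15 : (15 : ZMod p) ≠ 0) (K : Subgroup SL(3, ZMod p))
    {s : ZMod p} (hs : s ≠ 0) (hU : orthUpper 1 ∈ K) (hL : orthLower 1 ∈ K)
    (hL' : elem 0 2 s * orthLower 1 * (elem 0 2 s)⁻¹ ∈ K) : K = ⊤ := by
  have hU (k) : orthUpper k ∈ K := mem_of_map_add_mul K orthUpper orthUpper_add one_ne_zero hU k
  have hL (k) : orthLower k ∈ K := mem_of_map_add_mul K orthLower orthLower_add one_ne_zero hL k
  have hL' (k) : elem 0 2 s * orthLower k * (elem 0 2 s)⁻¹ ∈ K :=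
    mem_of_map_add_mul K (fun k ↦ elem 0 2 s * orthLower k * (elem 0 2 s)⁻¹)
      (fun a b ↦ by simp only [orthLower_add]; group) one_ne_zero hL' k
  have h4 : (4 : ZMod p) ≠ 0 := by
    rw [show (4 : ZMod p) = 2 * 2 by norm_num]
    exact mul_ne_zero h2 h2
  have hcomm (k : ZMod p) : elem 0 2 s * orthUpper k * (elem 0 2 s)⁻¹ = orthUpper k := by
    rw [mul_inv_eq_iff_eq_mul]
    apply eq_of_coe_eq
    simp only [Matrix.SpecialLinearGroup.coe_mul, coe_orthUpper, coe_elem_eq,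
      mul_fin_three]
    ext i j
    fin_cases i <;> fin_cases j <;> simp <;> ring
  set T := orthUpper 1 * orthLower (2⁻¹ : ZMod p) * orthUpper (-2⁻¹) * orthLower (-1) with hT
  have hTK : T ∈ K := K.mul_mem (K.mul_mem (K.mul_mem (hU _) (hL _)) (hU _)) (hL _)
  have hTK' : elem 0 2 s * T * (elem 0 2 s)⁻¹ ∈ K := by
    have : elem 0 2 s * T * (elem 0 2 s)⁻¹ =
        (elem 0 2 s * orthUpper 1 * (elem 0 2 s)⁻¹) *
        (elem 0 2 s * orthLower 2⁻¹ * (elem 0 2 s)⁻¹) *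
        (elem 0 2 s * orthUpper (-2⁻¹) * (elem 0 2 s)⁻¹) *
        (elem 0 2 s * orthLower (-1) * (elem 0 2 s)⁻¹) := by
      rw [hT]; group
    rw [this, hcomm, hcomm]
    exact K.mul_mem (K.mul_mem (K.mul_mem (hU _) (hL' _)) (hU _)) (hL' _)
  have h02 (c : ZMod p) : elem 0 2 c ∈ K := by
    have key : elem 0 2 (-15 * s) = elem 0 2 s * T * (elem 0 2 s)⁻¹ * T⁻¹ := by
      rw [elem_inv, mul_assoc (elem 0 2 s), torus_mul_elem h2, ← hT, ← mul_assoc,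
        mul_inv_cancel_right, ← elem_add]
      congr 1
      ring
    refine mem_of_map_add_mul K (fun c ↦ elem 0 2 c) (elem_add 0 2)
      (mul_ne_zero (neg_ne_zero.2 h15) hs) ?_ c
    simp only [key]
    exact K.mul_mem hTK' (K.inv_mem hTK)
  have hW : orthUpper 1 * orthLower (-2⁻¹) * orthUpper 1 ∈ K :=
    K.mul_mem (K.mul_mem (hU _) (hL _)) (hU _)
  have h20 (c : ZMod p) : elem 2 0 c ∈ K :=
    (K.mul_mem_cancel_right hW).1 (orthWeyl_mul_elem h2 c ▸ K.mul_mem hW (h02 _))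
  have hS : weylElem (ZMod p) ∈ K :=
    weylElem_eq (F := ZMod p) ▸ K.mul_mem (K.mul_mem (h02 _) (h20 _)) (h02 _)
  have h10 (c : ZMod p) : elem 1 0 c ∈ K := by
    have h := weylElem_mul_orthUpper_eq_elem_one_zero (c / 4)
    rw [mul_div_cancel₀ _ h4] at h
    exact (K.mul_mem_cancel_right (K.mul_mem (K.mul_mem (h20 _) (hL _)) hS)).1
      (h ▸ K.mul_mem hS (hU _))
  have h21 (c : ZMod p) : elem 2 1 c ∈ K := by
    have h := weylElem_mul_orthUpper_eq_elem_two_one (c / (-4))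
    rw [mul_div_cancel₀ _ (neg_ne_zero.2 h4)] at h
    exact (K.mul_mem_cancel_right (K.mul_mem (K.mul_mem (h20 _) (hL _)) hS)).1
      (h ▸ K.mul_mem hS (hU _))
  have h12 (c : ZMod p) : elem 1 2 c ∈ K :=
    (K.mul_mem_cancel_right hS).1 (weylElem_mul_elem_one_zero c ▸ K.mul_mem hS (h10 _))
  have h01 (c : ZMod p) : elem 0 1 c ∈ K :=
    (K.mul_mem_cancel_right hS).1 (weylElem_mul_elem_two_one c ▸ K.mul_mem hS (h21 _))
  apply eq_top_of_elem_mem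
  intro i j c h
  fin_cases i <;> fin_cases j <;> first | exact absurd rfl h | solve_by_elim

section Hyperbolic

variable {F : Type*} [Field F]

/-- The contragredient automorphism of `SL₃`. -/
def contra : SL(3, F) →* SL(3, F) where
  toFun A := A⁻¹.transpose
  map_one' := by
    apply eq_of_coe_eq
    simp only [inv_one, Matrix.SpecialLinearGroup.coe_transpose, Matrix.SpecialLinearGroup.coe_one,
      transpose_one]
  map_mul' A B := by
    apply eq_of_coe_eq
    simp only [_root_.mul_inv_rev, Matrix.SpecialLinearGroup.coe_mul,
      Matrix.SpecialLinearGroup.coe_transpose, transpose_mul]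

theorem mul_transpose_contra (A : SL(3, F)) :
    (A : Matrix (Fin 3) (Fin 3) F) * (contra A : Matrix (Fin 3) (Fin 3) F)ᵀ = 1 :=
  congrArg Subtype.val (mul_inv_cancel A)

theorem coe_contra_eq {A : SL(3, F)} {B : Matrix (Fin 3) (Fin 3) F}
    (h : (A : Matrix (Fin 3) (Fin 3) F) * Bᵀ = 1) : (contra A : Matrix (Fin 3) (Fin 3) F) = B :=
  transpose_injective (left_inv_eq_right_inv
    (mul_eq_one_comm.1 (mul_transpose_contra A)) h)

theorem contra_contra (A : SL(3, F)) : contra (contra A) = A := by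
  apply eq_of_coe_eq
  apply coe_contra_eq
  rw [← transpose_one, ← mul_transpose_contra A, transpose_mul, transpose_transpose]

/-- The embedding of `SL₃` as the stabilizer of the two summands in the orthogonal group of the
hyperbolic space of dimension six. -/
def hyp : SL(3, F) →* GL (Fin 3 ⊕ Fin 3) F :=
  MonoidHom.toHomUnits
    { toFun A := fromBlocks (A : Matrix (Fin 3) (Fin 3) F) 0 0 (contra A)
      map_one' := by simp
      map_mul' A B := by simp [fromBlocks_multiply] }

theorem coe_hyp (A : SL(3, F)) : (hyp A : Matrix (Fin 3 ⊕ Fin 3) (Fin 3 ⊕ Fin 3) F) =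
    fromBlocks (A : Matrix (Fin 3) (Fin 3) F) 0 0 (contra A) := rfl

theorem hyp_injective : Function.Injective (hyp (F := F)) := by
  intro A B h
  have h := congrArg Units.val h
  rw [coe_hyp, coe_hyp, fromBlocks_inj] at h
  exact eq_of_coe_eq h.1

theorem eq_hyp {g : GL (Fin 3 ⊕ Fin 3) F} {A B : Matrix (Fin 3) (Fin 3) F}
    (hg : (g : Matrix (Fin 3 ⊕ Fin 3) (Fin 3 ⊕ Fin 3) F) = fromBlocks A 0 0 B)
    (h : A.det = 1) (hAB : A * Bᵀ = 1) : g = hyp (mkSL A h) := by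
  apply Units.ext
  rw [hg, coe_hyp, coe_contra_eq (A := mkSL A h) hAB, coe_mkSL]

variable {tu : GL (Fin 3 ⊕ Fin 3) F}

theorem eq_hyp_mul
    (htu : (tu : Matrix (Fin 3 ⊕ Fin 3) (Fin 3 ⊕ Fin 3) F) = fromBlocks 0 1 1 0)
    {g : GL (Fin 3 ⊕ Fin 3) F} {A B : Matrix (Fin 3) (Fin 3) F}
    (hg : (g : Matrix (Fin 3 ⊕ Fin 3) (Fin 3 ⊕ Fin 3) F) = fromBlocks 0 A B 0)
    (h : A.det = 1) (hAB : A * Bᵀ = 1) : g = hyp (mkSL A h) * tu := by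
  apply Units.ext
  rw [Units.val_mul, hg, coe_hyp, coe_contra_eq (A := mkSL A h) hAB, coe_mkSL, htu,
    fromBlocks_multiply]
  simp

theorem swap_mul_self
    (htu : (tu : Matrix (Fin 3 ⊕ Fin 3) (Fin 3 ⊕ Fin 3) F) = fromBlocks 0 1 1 0) :
    tu * tu = 1 := by
  apply Units.ext
  simp [htu, fromBlocks_multiply]

theorem swap_mul_hyp
    (htu : (tu : Matrix (Fin 3 ⊕ Fin 3) (Fin 3 ⊕ Fin 3) F) = fromBlocks 0 1 1 0)
    (A : SL(3, F)) : tu * hyp A = hyp (contra A) * tu := by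
  apply Units.ext
  simp [htu, coe_hyp, contra_contra, fromBlocks_multiply]

theorem swap_mul_hyp_eq_iff
    (htu : (tu : Matrix (Fin 3 ⊕ Fin 3) (Fin 3 ⊕ Fin 3) F) = fromBlocks 0 1 1 0)
    (A : SL(3, F)) : tu * hyp A = hyp A * tu ↔ contra A = A := by
  rw [swap_mul_hyp htu, mul_left_inj, hyp_injective.eq_iff]

/-- Every element of the group generated by the stabilizer of the two summands and the swap either
fixes or exchanges the summands. -/
theorem exists_eq_of_mem_closure
    (htu : (tu : Matrix (Fin 3 ⊕ Fin 3) (Fin 3 ⊕ Fin 3) F) = fromBlocks 0 1 1 0)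
    {g : GL (Fin 3 ⊕ Fin 3) F} (hg : g ∈ Subgroup.closure (Set.range (hyp (F := F)) ∪ {tu})) :
    ∃ A, g = hyp A ∨ g = hyp A * tu := by
  induction hg using Subgroup.closure_induction with
  | mem x hx =>
    rcases hx with ⟨A, rfl⟩ | rfl
    · exact ⟨A, .inl rfl⟩
    · exact ⟨1, .inr (by simp)⟩
  | one => exact ⟨1, .inl (by simp)⟩
  | mul x y _ _ hx hy =>
    obtain ⟨A, rfl | rfl⟩ := hx <;> obtain ⟨B, rfl | rfl⟩ := hy
    · exact ⟨A * B, .inl (by simp)⟩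
    · exact ⟨A * B, .inr (by simp [mul_assoc])⟩
    · exact ⟨A * contra B, .inr (by rw [mul_assoc, swap_mul_hyp htu, map_mul, mul_assoc])⟩
    · exact ⟨A * contra B, .inl (by
        rw [mul_assoc, ← mul_assoc tu, swap_mul_hyp htu, mul_assoc, swap_mul_self htu, mul_one,
          map_mul])⟩
  | inv x _ hx =>
    obtain ⟨A, rfl | rfl⟩ := hx
    · exact ⟨A⁻¹, .inl (by simp)⟩
    · refine ⟨contra A⁻¹, .inr ?_⟩
      rw [_root_.mul_inv_rev, ← map_inv, ← swap_mul_hyp htu,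
        inv_eq_of_mul_eq_one_right (swap_mul_self htu)]

end Hyperbolic

section Frame

variable {F : Type*} [Field F]

/-- The change of basis under which `invT * invB` becomes `orthUpper 1` and the standard form
becomes antidiagonal. -/
def frame (r i s : F) : Matrix (Fin 3) (Fin 3) F :=
  !![0, i, -i;
    -(s * i) - s * r - s * i * r, s * i + s * r + s * i * r, -(s * i) - s * i * r;
    -s - s * r + s * i * r, s + s * r - s * i * r, s * i * r]

/-- The diagonal block of the second generator. -/
def invT (F : Type*) [Field F] : Matrix (Fin 3) (Fin 3) F := !![1, 0, 0; 0, -1, 0; 0, 0, -1]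

/-- The diagonal block of the third generator, in terms of the parameters. -/
def invB (r i s : F) : Matrix (Fin 3) (Fin 3) F :=
  !![1, 2 * s + 2 * s * r - 2 * s * i * r, -(2 * s * i) - 2 * s * r - 2 * s * i * r;
    2 * s + 2 * s * r - 2 * s * i * r, 1 + 4 * i + 4 * r, 4 - 2 * i - 4 * i * r;
    -(2 * s * i) - 2 * s * r - 2 * s * i * r, 4 - 2 * i - 4 * i * r, -3 - 4 * i - 4 * r]

/-- The off-diagonal block of the first generator, in terms of the parameters. -/
def invA (r i s : F) : Matrix (Fin 3) (Fin 3) F :=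
  !![0, s * i * r, s * i + s * i * r; s * i * r, r, 1; s * i + s * i * r, 1, -1 - r]

/-- The upper off-diagonal block of the fourth generator. -/
def matC (r : F) : Matrix (Fin 3) (Fin 3) F := !![-r, 0, 0; 0, 0, r; 0, r, 2 + r]

/-- The lower off-diagonal block of the fourth generator. -/
def matD (r : F) : Matrix (Fin 3) (Fin 3) F := !![1 + r, 0, 0; 0, 1 - r, -1 - r; 0, -1 - r, 0]

/-- The upper off-diagonal block of the element whose centralizer occurs in the main theorem. -/
def matR (r i : F) : Matrix (Fin 3) (Fin 3) F :=
  !![r, 0, 0;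
    0, 4 * i + 4 * r + 2 * i * r, 4 + 2 * r - 3 * i * r;
    0, 4 + 2 * r - 3 * i * r, -(4 * i) - 2 * r - 2 * i * r]

/-- The lower off-diagonal block of the element whose centralizer occurs in the main theorem. -/
def matR' (r i : F) : Matrix (Fin 3) (Fin 3) F :=
  !![-1 - r, 0, 0;
    0, 2 + 2 * i + 2 * r - 2 * i * r, 2 - 3 * i - 2 * r - 3 * i * r;
    0, 2 - 3 * i - 2 * r - 3 * i * r, -4 - 2 * i - 4 * r + 2 * i * r]

variable {r i s : F}

theorem det_frame (hr : r ^ 2 + r + 1 = 0) (hi : i ^ 2 = -1) (hs : s ^ 2 = 1) :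
    (frame r i s).det = 1 := by
  simp only [det_fin_three, frame, of_apply, cons_val]
  grind

theorem det_invT : (invT F).det = 1 := by
  simp [det_fin_three, invT]

theorem det_invB (hr : r ^ 2 + r + 1 = 0) (hi : i ^ 2 = -1) :
    (invB r i s).det = 1 := by
  simp only [det_fin_three, invB, of_apply, cons_val]
  grind

theorem det_invA (hr : r ^ 2 + r + 1 = 0) (hi : i ^ 2 = -1) (hs : s ^ 2 = 1) :
    (invA r i s).det = 1 := by
  simp only [det_fin_three, invA, of_apply, cons_val]
  grind

theorem det_matC (hr : r ^ 2 + r + 1 = 0) :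
    (matC r).det = 1 := by
  simp only [det_fin_three, matC, of_apply, cons_val]
  grind

theorem det_matR (hr : r ^ 2 + r + 1 = 0) (hi : i ^ 2 = -1) :
    (matR r i).det = 1 := by
  simp only [det_fin_three, matR, of_apply, cons_val]
  grind

theorem invT_mul_transpose : invT F * (invT F)ᵀ = 1 := by
  ext i j
  fin_cases i <;> fin_cases j <;> simp [invT, mul_apply, Fin.sum_univ_three]

theorem invB_mul_transpose (hr : r ^ 2 + r + 1 = 0) (hi : i ^ 2 = -1) (hs : s ^ 2 = 1) :
    invB r i s * (invB r i s)ᵀ = 1 := by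
  ext i j
  fin_cases i <;> fin_cases j <;> simp [invB, mul_apply, Fin.sum_univ_three] <;> grind

theorem invA_mul_transpose (hr : r ^ 2 + r + 1 = 0) (hi : i ^ 2 = -1) (hs : s ^ 2 = 1) :
    invA r i s * (invA r i s)ᵀ = 1 := by
  ext i j
  fin_cases i <;> fin_cases j <;> simp [invA, mul_apply, Fin.sum_univ_three] <;> grind

theorem matC_mul_matD (hr : r ^ 2 + r + 1 = 0) : matC r * (matD r)ᵀ = 1 := by
  ext i j
  fin_cases i <;> fin_cases j <;> simp [matC, matD, mul_apply, Fin.sum_univ_three] <;> grind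

theorem matR_mul_matR' (hr : r ^ 2 + r + 1 = 0) (hi : i ^ 2 = -1) :
    matR r i * (matR' r i)ᵀ = 1 := by
  ext i j
  fin_cases i <;> fin_cases j <;> simp [matR, matR', mul_apply, Fin.sum_univ_three] <;> grind

theorem matC_mul_matR' (hr : r ^ 2 + r + 1 = 0) :
    matC r * matR' r i = matR r i * matD r := by
  simp only [matC, matD, matR, matR', mul_fin_three]
  ext i j
  fin_cases i <;> fin_cases j <;> simp <;> grind

theorem matR_mul_invT (r i : F) : matR r i * invT F = invT F * matR r i := by
  simp only [matR, invT, mul_fin_three]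
  ext i j
  fin_cases i <;> fin_cases j <;> simp

theorem matR_mul_invB (hr : r ^ 2 + r + 1 = 0) (hi : i ^ 2 = -1) :
    matR r i * invB r i s = invB r i s * matR r i := by
  simp only [matR, invB, mul_fin_three]
  ext i j
  fin_cases i <;> fin_cases j <;> simp <;> grind

theorem matD_mul_matR (hr : r ^ 2 + r + 1 = 0) : matD r * matR r i = matR' r i * matC r := by
  simp only [matC, matD, matR, matR', mul_fin_three]
  ext i j
  fin_cases i <;> fin_cases j <;> simp <;> grind

theorem matR_mul_frame (hr : r ^ 2 + r + 1 = 0) (hi : i ^ 2 = -1) :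
    matR r i * frame r i s = frame r i s * !![r, 0, -2 - r; 0, r, 0; 0, 0, r] := by
  simp only [frame, matR, mul_fin_three]
  ext i j
  fin_cases i <;> fin_cases j <;> simp <;> grind

theorem invT_mul_frame (r i s : F) :
    invT F * frame r i s = frame r i s * !![-1, 2, -2; 0, 1, -2; 0, 0, -1] := by
  simp only [frame, invT, mul_fin_three]
  ext i j
  fin_cases i <;> fin_cases j <;> simp <;> grind

theorem invB_mul_frame (hr : r ^ 2 + r + 1 = 0) (hi : i ^ 2 = -1) (hs : s ^ 2 = 1) :
    invB r i s * frame r i s = frame r i s * !![-1, 0, 0; 0, 1, 0; 0, 0, -1] := by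
  simp only [frame, invB, mul_fin_three]
  ext i j
  fin_cases i <;> fin_cases j <;> simp <;> grind

theorem invA_mul_frame (hr : r ^ 2 + r + 1 = 0) (hi : i ^ 2 = -1) (hs : s ^ 2 = 1) :
    invA r i s * frame r i s = frame r i s * !![0, 0, -1; 0, -1, 0; -1, 0, 0] := by
  simp only [frame, invA, mul_fin_three]
  ext i j
  fin_cases i <;> fin_cases j <;> simp <;> grind

theorem matD_mul_frame (hr : r ^ 2 + r + 1 = 0) :
    matD r * frame r i s = frame r i s * !![1, r, -r; 1 + r, 0, -r; 1 + r, -1 - r, 1] := by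
  simp only [frame, matD, mul_fin_three]
  ext i j
  fin_cases i <;> fin_cases j <;> simp <;> grind

theorem transpose_frame_mul_frame (hr : r ^ 2 + r + 1 = 0) (hi : i ^ 2 = -1) (hs : s ^ 2 = 1) :
    (frame r i s)ᵀ * frame r i s = !![0, 0, 1; 0, -1, 0; 1, 0, 0] := by
  ext i j
  fin_cases i <;> fin_cases j <;> simp [frame, mul_apply, Fin.sum_univ_three] <;> grind

end Frame

theorem frame_conj_orthUpper {F : Type*} [Field F] {r i s : F} (hr : r ^ 2 + r + 1 = 0)
    (hi : i ^ 2 = -1) (hs : s ^ 2 = 1) :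
    mkSL (frame r i s) (det_frame hr hi hs) * orthUpper 1 *
        (mkSL (frame r i s) (det_frame hr hi hs))⁻¹ =
      mkSL (invT F) det_invT * mkSL (invB r i s) (det_invB hr hi) := by
  rw [mul_inv_eq_iff_eq_mul]
  apply eq_of_coe_eq
  simp only [Matrix.SpecialLinearGroup.coe_mul, coe_mkSL, coe_orthUpper]
  rw [Matrix.mul_assoc, invB_mul_frame hr hi hs, ← Matrix.mul_assoc, invT_mul_frame,
    Matrix.mul_assoc, mul_fin_three]
  congr 1
  ext i j
  fin_cases i <;> fin_cases j <;> norm_num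

/-- The product of the two involutions and its conjugates by the matrices `A` and `C` generate
`SL₃` over the prime field. -/
theorem eq_top_of_conj_mem {p : ℕ} [Fact p.Prime] (h2 : (2 : ZMod p) ≠ 0)
    (h15 : (15 : ZMod p) ≠ 0) {r i s : ZMod p} (hr : r ^ 2 + r + 1 = 0) (hi : i ^ 2 = -1)
    (hs : s ^ 2 = 1) (K : Subgroup SL(3, ZMod p)) {T B A C : SL(3, ZMod p)}
    (hT : T = mkSL (invT _) det_invT) (hB : B = mkSL (invB r i s) (det_invB hr hi))
    (hA : A = mkSL (invA r i s) (det_invA hr hi hs)) (hC : C = mkSL (matC r) (det_matC hr))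
    (hTB : T * B ∈ K) (hTBA : A * (T * B) * A⁻¹ ∈ K) (hTBC : C * (T * B) * C⁻¹ ∈ K) :
    K = ⊤ := by
  set P := mkSL (frame r i s) (det_frame hr hi hs) with hP
  have hTB' : P * orthUpper 1 * P⁻¹ = T * B := by
    rw [hT, hB, frame_conj_orthUpper hr hi hs]
  let W : SL(3, ZMod p) := mkSL !![0, 0, -1; 0, -1, 0; -1, 0, 0] (by simp [det_fin_three])
  have hW : P * W * P⁻¹ = A := by
    rw [mul_inv_eq_iff_eq_mul, hA]
    exact eq_of_coe_eq (invA_mul_frame hr hi hs).symm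
  have hWU : orthLower 1 = W * orthUpper 1 * W⁻¹ := by
    rw [eq_mul_inv_iff_mul_eq]
    apply eq_of_coe_eq
    simp only [W, Matrix.SpecialLinearGroup.coe_mul, coe_mkSL, coe_orthUpper, coe_orthLower,
      mul_fin_three]
    ext i j
    fin_cases i <;> fin_cases j <;> simp
  let X : SL(3, ZMod p) := mkSL !![1, r, -r; 1 + r, 0, -r; 1 + r, -1 - r, 1] (by
    simp only [det_fin_three, of_apply, cons_val]
    grind)
  have hX : P * X⁻¹ * P⁻¹ = C := by
    have hD : (matD r).det = 1 := by
      simp only [det_fin_three, matD, of_apply, cons_val]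
      grind
    have hCD : C * mkSL (matD r) hD = 1 := by
      apply eq_of_coe_eq
      rw [hC, Matrix.SpecialLinearGroup.coe_mul, coe_mkSL, coe_mkSL]
      exact (by simp [matD, ← ext_iff, Fin.forall_fin_succ] : (matD r)ᵀ = matD r) ▸ matC_mul_matD hr
    have hDX : mkSL (matD r) hD * P = P * X := eq_of_coe_eq (matD_mul_frame hr)
    rw [eq_inv_of_mul_eq_one_left hCD, eq_mul_inv_iff_mul_eq.2 hDX]
    group
  set σ : ZMod p := 2⁻¹ + r with hσ
  have h22 : (2 : ZMod p) * 2⁻¹ = 1 := mul_inv_cancel₀ h2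
  have hUX : orthUpper 2⁻¹ * elem 0 2 σ * orthLower 1 * (orthUpper 2⁻¹ * elem 0 2 σ)⁻¹ =
      X⁻¹ * orthUpper 1 * X := by
    rw [mul_inv_eq_iff_eq_mul, mul_assoc X⁻¹, mul_assoc X⁻¹, eq_inv_mul_iff_mul_eq]
    apply eq_of_coe_eq
    simp only [X, Matrix.SpecialLinearGroup.coe_mul, coe_mkSL, coe_orthUpper, coe_orthLower,
      coe_elem_eq, mul_fin_three, hσ]
    generalize (2 : ZMod p)⁻¹ = t at h22
    ext i j
    fin_cases i <;> fin_cases j <;> simp <;> grind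
  have key : K.comap (MulAut.conj P).toMonoidHom = ⊤ := by
    have hU : orthUpper 1 ∈ K.comap (MulAut.conj P).toMonoidHom := by
      simpa [hTB'] using hTB
    refine eq_top_of_orthUpper_mem h2 h15 _ (s := σ) ?_ hU ?_ ?_
    · intro h
      have e : 1 + 2 * r = 0 := by linear_combination 2 * h - h22
      exact h15 (by linear_combination -5 * (1 + 2 * r) * e + 20 * hr)
    · suffices P * orthLower 1 * P⁻¹ = A * (T * B) * A⁻¹ by simpa [this] using hTBA
      rw [hWU, ← hW, ← hTB']
      group
    · have hU' : orthUpper 2⁻¹ ∈ K.comap (MulAut.conj P).toMonoidHom :=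
        mem_of_map_add_mul _ orthUpper orthUpper_add one_ne_zero hU _
      rw [← Subgroup.mul_mem_cancel_left _ hU', ← Subgroup.mul_mem_cancel_right _ (inv_mem hU')]
      suffices P * (orthUpper 2⁻¹ * elem 0 2 σ * orthLower 1 * (orthUpper 2⁻¹ * elem 0 2 σ)⁻¹) *
          P⁻¹ = C * (T * B) * C⁻¹ by
        rw [← this] at hTBC
        simpa only [Subgroup.mem_comap, MulEquiv.coe_toMonoidHom, MulAut.conj_apply, mul_assoc,
          _root_.mul_inv_rev] using hTBC
      rw [hUX, ← hX, ← hTB']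
      group
  rw [eq_top_iff]
  intro Z _
  have : P⁻¹ * Z * P ∈ K.comap (MulAut.conj P).toMonoidHom := key ▸ Subgroup.mem_top _
  simpa [mul_assoc] using this

/-- The centralizer of a root element in the special orthogonal group of a conic. -/
theorem eq_orthUpper_or_of_commute {F : Type*} [Field F] (h2 : (2 : F) ≠ 0) {r n : F} (hn : n ≠ 0)
    {X : Matrix (Fin 3) (Fin 3) F} (hX : X.det = 1)
    (hJ : Xᵀ * !![0, 0, 1; 0, -1, 0; 1, 0, 0] * X = !![0, 0, 1; 0, -1, 0; 1, 0, 0])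
    (hXn : X * !![r, 0, n; 0, r, 0; 0, 0, r] = !![r, 0, n; 0, r, 0; 0, 0, r] * X) :
    ∃ k : F, X = (orthUpper k : Matrix (Fin 3) (Fin 3) F) ∨
      X = (orthUpper k : Matrix (Fin 3) (Fin 3) F) * !![-1, 0, 0; 0, 1, 0; 0, 0, -1] := by
  have e (i j) := congrFun (congrFun hXn i) j
  have f (i j) := congrFun (congrFun hJ i) j
  have e22 := e 2 2
  have e12 := e 1 2
  have e02 := e 0 2
  have e01 := e 0 1
  have f02 := f 0 2
  have f12 := f 1 2
  have f22 := f 2 2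
  simp [mul_apply, Fin.sum_univ_three] at e22 e12 e02 e01 f02 f12 f22
  have x20 : X 2 0 = 0 := by grind
  have x10 : X 1 0 = 0 := by grind
  have x21 : X 2 1 = 0 := by grind
  have x22 : X 2 2 = X 0 0 := by grind
  rw [det_fin_three] at hX
  have x11 : X 1 1 = 1 := by grind
  have x00 : (X 0 0 - 1) * (X 0 0 + 1) = 0 := by grind
  have h22 : (2 : F) * 2⁻¹ = 1 := mul_inv_cancel₀ h2
  refine ⟨2⁻¹ * X 0 1, ?_⟩
  rw [coe_orthUpper]
  generalize (2 : F)⁻¹ = t at h22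
  rcases mul_eq_zero.1 x00 with h | h
  · left
    ext i j
    fin_cases i <;> fin_cases j <;> simp <;> grind
  · right
    rw [mul_fin_three]
    ext i j
    fin_cases i <;> fin_cases j <;> simp <;> grind

/-- An orthogonal matrix of determinant one commuting with `matR` lies in the group generated by
the two involutions. -/
theorem mem_of_contra_eq_self {p : ℕ} [Fact p.Prime] (h2 : (2 : ZMod p) ≠ 0)
    (h3 : (3 : ZMod p) ≠ 0) {r i s : ZMod p} (hr : r ^ 2 + r + 1 = 0) (hi : i ^ 2 = -1)
    (hs : s ^ 2 = 1) (K : Subgroup SL(3, ZMod p)) {T B A : SL(3, ZMod p)}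
    (hT : T = mkSL (invT _) det_invT) (hB : B = mkSL (invB r i s) (det_invB hr hi))
    (hTK : T ∈ K) (hBK : B ∈ K) (hA : contra A = A)
    (hAR : (A : Matrix (Fin 3) (Fin 3) (ZMod p)) * matR r i = matR r i * A) : A ∈ K := by
  set P := mkSL (frame r i s) (det_frame hr hi hs) with hP
  have hU : orthUpper 1 ∈ K.comap (MulAut.conj P).toMonoidHom := by
    have := K.mul_mem hTK hBK
    rw [hT, hB, ← frame_conj_orthUpper hr hi hs] at this
    exact this
  have hS : P⁻¹ * B * P ∈ K.comap (MulAut.conj P).toMonoidHom := by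
    simpa [mul_assoc] using hBK
  have hS' : ((P⁻¹ * B * P : SL(3, ZMod p)) : Matrix (Fin 3) (Fin 3) (ZMod p)) =
      !![-1, 0, 0; 0, 1, 0; 0, 0, -1] := by
    suffices P⁻¹ * B * P = mkSL !![-1, 0, 0; 0, 1, 0; 0, 0, -1] (by simp [det_fin_three]) from
      congrArg Subtype.val this
    rw [mul_assoc, inv_mul_eq_iff_eq_mul, hB]
    exact eq_of_coe_eq (invB_mul_frame hr hi hs)
  set X := P⁻¹ * A * P with hX
  have hPX : P * X = A * P := by rw [hX]; group
  have hPX' : frame r i s * (X : Matrix (Fin 3) (Fin 3) (ZMod p)) =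
      (A : Matrix (Fin 3) (Fin 3) (ZMod p)) * frame r i s :=
    congrArg Subtype.val hPX
  have hAA := mul_eq_one_comm.1 (mul_transpose_contra A)
  rw [hA] at hAA
  have hJ : (X : Matrix (Fin 3) (Fin 3) (ZMod p))ᵀ * !![0, 0, 1; 0, -1, 0; 1, 0, 0] *
      (X : Matrix (Fin 3) (Fin 3) (ZMod p)) = !![0, 0, 1; 0, -1, 0; 1, 0, 0] := by
    rw [← transpose_frame_mul_frame hr hi hs, ← Matrix.mul_assoc, ← transpose_mul,
      Matrix.mul_assoc, hPX', transpose_mul, Matrix.mul_assoc,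
      ← Matrix.mul_assoc _ (A : Matrix (Fin 3) (Fin 3) (ZMod p)), hAA, Matrix.one_mul]
  have hXn : (X : Matrix (Fin 3) (Fin 3) (ZMod p)) * !![r, 0, -2 - r; 0, r, 0; 0, 0, r] =
      !![r, 0, -2 - r; 0, r, 0; 0, 0, r] * (X : Matrix (Fin 3) (Fin 3) (ZMod p)) := by
    have hunit : IsUnit (frame r i s) := by
      rw [isUnit_iff_isUnit_det, det_frame hr hi hs]
      exact isUnit_one
    rw [← hunit.mul_right_inj, ← Matrix.mul_assoc, hPX', Matrix.mul_assoc,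
      ← matR_mul_frame hr hi, ← Matrix.mul_assoc, hAR, ← Matrix.mul_assoc,
      ← matR_mul_frame hr hi, Matrix.mul_assoc, Matrix.mul_assoc, hPX']
  have hn : -2 - r ≠ 0 := by
    intro h
    exact h3 (by linear_combination hr + (r - 1) * h)
  have hXK : X ∈ K.comap (MulAut.conj P).toMonoidHom := by
    obtain ⟨k, hk | hk⟩ := eq_orthUpper_or_of_commute h2 hn X.2 hJ hXn
    · rw [eq_of_coe_eq hk]
      exact mem_of_map_add_mul _ orthUpper orthUpper_add one_ne_zero hU _
    · rw [← hS', ← Matrix.SpecialLinearGroup.coe_mul] at hk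
      rw [eq_of_coe_eq hk]
      exact mul_mem (mem_of_map_add_mul _ orthUpper orthUpper_add one_ne_zero hU _) hS
  simpa [hX, mul_assoc] using hXK

section Hyperbolic

variable {F : Type*} [Field F] {tu : GL (Fin 3 ⊕ Fin 3) F}

theorem contra_mkSL_eq {A : Matrix (Fin 3) (Fin 3) F} (h : A.det = 1)
    (hA : A * Aᵀ = 1) : contra (mkSL A h) = mkSL A h :=
  eq_of_coe_eq (coe_contra_eq (A := mkSL A h) hA)

theorem hyp_mul_swap_conj
    (htu : (tu : Matrix (Fin 3 ⊕ Fin 3) (Fin 3 ⊕ Fin 3) F) = fromBlocks 0 1 1 0)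
    {Z : SL(3, F)} (hZ : contra Z = Z) (A : SL(3, F)) :
    hyp A * tu * hyp Z * (hyp A * tu)⁻¹ = hyp (A * Z * A⁻¹) := by
  rw [mul_inv_eq_iff_eq_mul, mul_assoc (hyp A), swap_mul_hyp htu, hZ, ← mul_assoc, ← mul_assoc,
    ← map_mul, ← map_mul, inv_mul_cancel_right]

theorem hyp_mul_swap_mul_hyp
    (htu : (tu : Matrix (Fin 3 ⊕ Fin 3) (Fin 3 ⊕ Fin 3) F) = fromBlocks 0 1 1 0)
    {Z : SL(3, F)} (hZ : contra Z = Z) {A : SL(3, F)} (hAZ : A * Z = Z * A) :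
    hyp A * tu * hyp Z = hyp Z * (hyp A * tu) := by
  rw [mul_assoc, swap_mul_hyp htu, hZ, ← mul_assoc, ← mul_assoc, ← map_mul, ← map_mul, hAZ]

theorem range_hyp : Set.range (hyp (F := F)) =
    {g : GL (Fin 3 ⊕ Fin 3) F | ∃ A : Matrix (Fin 3) (Fin 3) F, A.det = 1 ∧
      (g : Matrix (Fin 3 ⊕ Fin 3) (Fin 3 ⊕ Fin 3) F) = fromBlocks A 0 0 (Aᵀ)⁻¹} := by
  ext g
  constructor
  · rintro ⟨A, rfl⟩
    refine ⟨A, A.2, ?_⟩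
    rw [coe_hyp]
    congr 1
    refine (inv_eq_left_inv ?_).symm
    rw [← transpose_one, ← mul_transpose_contra A, transpose_mul, transpose_transpose]
  · rintro ⟨A, hA, hg⟩
    refine ⟨mkSL A hA, (eq_hyp hg hA ?_).symm⟩
    rw [transpose_nonsing_inv, transpose_transpose, mul_nonsing_inv _ (by simp [hA])]

end Hyperbolic

section Subgroups

variable {p : ℕ} [Fact p.Prime] {r i s : ZMod p} {T B A C : SL(3, ZMod p)}
  {tu u1 u2 u3 u4 : GL (Fin 3 ⊕ Fin 3) (ZMod p)}

theorem closure_eq_closure_range_hyp (h2 : (2 : ZMod p) ≠ 0) (h15 : (15 : ZMod p) ≠ 0)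
    (hr : r ^ 2 + r + 1 = 0) (hi : i ^ 2 = -1) (hs : s ^ 2 = 1)
    (hT : T = mkSL (invT _) det_invT) (hB : B = mkSL (invB r i s) (det_invB hr hi))
    (hA : A = mkSL (invA r i s) (det_invA hr hi hs)) (hC : C = mkSL (matC r) (det_matC hr))
    (hT' : contra T = T) (hB' : contra B = B)
    (htu : (tu : Matrix (Fin 3 ⊕ Fin 3) (Fin 3 ⊕ Fin 3) (ZMod p)) = fromBlocks 0 1 1 0)
    (hu1 : u1 = hyp A * tu) (hu2 : u2 = hyp T) (hu3 : u3 = hyp B) (hu4 : u4 = hyp C * tu) :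
    Subgroup.closure {u1, u2, u3, u4} =
      Subgroup.closure (Set.range (hyp (F := ZMod p)) ∪ {tu}) := by
  apply le_antisymm
  · have hh (Z : SL(3, ZMod p)) :
        hyp Z ∈ Subgroup.closure (Set.range (hyp (F := ZMod p)) ∪ {tu}) :=
      Subgroup.subset_closure (.inl ⟨Z, rfl⟩)
    have ht : tu ∈ Subgroup.closure (Set.range (hyp (F := ZMod p)) ∪ {tu}) :=
      Subgroup.subset_closure (.inr rfl)
    rw [Subgroup.closure_le]
    rintro g (rfl | rfl | rfl | rfl)
    · exact hu1 ▸ mul_mem (hh _) ht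
    · exact hu2 ▸ hh _
    · exact hu3 ▸ hh _
    · exact hu4 ▸ mul_mem (hh _) ht
  · set M := Subgroup.closure {u1, u2, u3, u4}
    have hM1 : u1 ∈ M := Subgroup.subset_closure (by simp)
    have hM4 : u4 ∈ M := Subgroup.subset_closure (by simp)
    have hM : hyp (T * B) ∈ M := by
      rw [map_mul, ← hu2, ← hu3]
      exact mul_mem (Subgroup.subset_closure (by simp)) (Subgroup.subset_closure (by simp))
    have hTB : contra (T * B) = T * B := by rw [map_mul, hT', hB']
    have hK : M.comap hyp = ⊤ := by
      refine eq_top_of_conj_mem h2 h15 hr hi hs _ hT hB hA hC hM ?_ ?_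
      · rw [Subgroup.mem_comap, ← hyp_mul_swap_conj htu hTB, ← hu1]
        exact mul_mem (mul_mem hM1 hM) (inv_mem hM1)
      · rw [Subgroup.mem_comap, ← hyp_mul_swap_conj htu hTB, ← hu4]
        exact mul_mem (mul_mem hM4 hM) (inv_mem hM4)
    have hh (Z : SL(3, ZMod p)) : hyp Z ∈ M := by
      have : Z ∈ M.comap hyp := hK ▸ Subgroup.mem_top Z
      exact this
    rw [Subgroup.closure_le]
    rintro g (⟨Z, rfl⟩ | rfl)
    · exact hh Z
    · exact (M.mul_mem_cancel_left (hh A)).1 (hu1 ▸ hM1)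

theorem mem_closure_of_mem_centralizer (h2 : (2 : ZMod p) ≠ 0) (h3 : (3 : ZMod p) ≠ 0)
    (hr : r ^ 2 + r + 1 = 0) (hi : i ^ 2 = -1) (hs : s ^ 2 = 1)
    (hT : T = mkSL (invT _) det_invT) (hB : B = mkSL (invB r i s) (det_invB hr hi))
    {ru : GL (Fin 3 ⊕ Fin 3) (ZMod p)}
    (htu : (tu : Matrix (Fin 3 ⊕ Fin 3) (Fin 3 ⊕ Fin 3) (ZMod p)) = fromBlocks 0 1 1 0)
    (hu2 : u2 = hyp T) (hu3 : u3 = hyp B) (hru : ru = hyp (mkSL (matR r i) (det_matR hr hi)) * tu)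
    {g : GL (Fin 3 ⊕ Fin 3) (ZMod p)}
    (hg : g ∈ Subgroup.closure (Set.range (hyp (F := ZMod p)) ∪ {tu}))
    (hgt : tu * g = g * tu) (hgr : ru * g = g * ru) : g ∈ Subgroup.closure {u2, u3} := by
  set R := mkSL (matR r i) (det_matR hr hi) with hR
  have hR' : (contra R : Matrix (Fin 3) (Fin 3) (ZMod p)) = matR' r i :=
    coe_contra_eq (matR_mul_matR' hr hi)
  obtain ⟨X, rfl | rfl⟩ := exists_eq_of_mem_closure htu hg
  · have hX : contra X = X := (swap_mul_hyp_eq_iff htu X).1 hgt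
    rw [hru, mul_assoc, swap_mul_hyp htu, hX, ← mul_assoc, ← mul_assoc, mul_left_inj, ← map_mul,
      ← map_mul, hyp_injective.eq_iff] at hgr
    refine mem_of_contra_eq_self h2 h3 hr hi hs ((Subgroup.closure {u2, u3}).comap hyp) hT hB ?_ ?_
      hX (congrArg Subtype.val hgr.symm)
    · exact hu2 ▸ Subgroup.subset_closure (by simp)
    · exact hu3 ▸ Subgroup.subset_closure (by simp)
  · rw [← mul_assoc, mul_left_inj] at hgt
    have hX : contra X = X := (swap_mul_hyp_eq_iff htu X).1 hgt
    have hXR : R * X = X * contra R := by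
      rw [hru, mul_assoc, ← mul_assoc tu, swap_mul_hyp htu, hX, mul_assoc, swap_mul_self htu,
        mul_assoc, ← mul_assoc tu, swap_mul_hyp htu, mul_assoc, swap_mul_self htu, mul_one,
        mul_one, ← map_mul, ← map_mul, hyp_injective.eq_iff] at hgr
      exact hgr
    have htr : (matR r i).trace = (matR' r i).trace := by
      have h : R = X * contra R * X⁻¹ := by rw [← hXR, mul_inv_cancel_right]
      have h := congrArg (fun Z : SL(3, ZMod p) ↦ (Z : Matrix (Fin 3) (Fin 3) (ZMod p)).trace) h
      simp only [Matrix.SpecialLinearGroup.coe_mul] at h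
      rwa [trace_mul_comm, ← Matrix.mul_assoc, ← Matrix.SpecialLinearGroup.coe_mul,
        inv_mul_cancel, Matrix.SpecialLinearGroup.coe_one, Matrix.one_mul, hR'] at h
    simp only [trace_fin_three, matR, matR', of_apply, cons_val] at htr
    have h : 3 * (1 + 2 * r) = 0 := by linear_combination htr
    have h : 1 + 2 * r = 0 := (mul_eq_zero.1 h).resolve_left h3
    exact absurd (by linear_combination -(1 + 2 * r) * h + 4 * hr) h3

end Subgroups

theorem not_dvd_thirty {p : ℕ} (hp3 : p % 3 = 1) (hp8 : p % 8 = 5) : ¬p ∣ 30 := by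
  intro h
  have := Nat.le_of_dvd (by decide) h
  interval_cases p <;> omega

theorem sq_add_self_add_one_eq_zero_of_orderOf {F : Type*} [Field F] {r : F} (h : orderOf r = 3) :
    r ^ 2 + r + 1 = 0 := by
  have h3 : r ^ 3 = 1 := h ▸ pow_orderOf_eq_one r
  have h1 : r ≠ 1 := by
    rintro rfl
    simp at h
  apply mul_left_cancel₀ (sub_ne_zero.2 h1)
  linear_combination h3

/-- The parameters of the generators, expressed as polynomials in `r`, `i` and a sign `s`. -/
theorem exists_parameters {F : Type*} [Field F] (h2 : (2 : F) ≠ 0)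
    {r i alpha lam eps beta gamma delta a x y b c d : F} (hr : r ^ 2 + r + 1 = 0)
    (hi : i ^ 2 = -1) (halpha : alpha ^ 2 = (1 + r ^ 2)⁻¹)
    (hlam : lam = alpha * (i + 1) * (-1 + r - i * r ^ 2)) (heps : eps = -i * lam)
    (hbeta : beta = -2⁻¹ * lam ^ 2 * i) (hgamma : gamma = 2⁻¹ * lam ^ 2 - 1)
    (hdelta : delta = -1 - 2⁻¹ * lam ^ 2) (ha : a = 2 * (2 * r ^ 2 + (1 - r) * i)⁻¹)
    (hx : x = -2⁻¹ * a * r * (1 - r)) (hy : y = -x * r) (hb : b = a⁻¹ * (r ^ 2 + x ^ 2))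
    (hc : c = a⁻¹ * (1 + x ^ 2 * r)) (hd : d = a * r) :
    ∃ s, s ^ 2 = 1 ∧ alpha = s * i * r ∧ lam = 2 * s + 2 * s * r - 2 * s * i * r ∧
      eps = -(2 * s * i) - 2 * s * r - 2 * s * i * r ∧ beta = 4 - 2 * i - 4 * i * r ∧
      gamma = 1 + 4 * i + 4 * r ∧ delta = -3 - 4 * i - 4 * r ∧ a = 4 * i + 4 * r + 2 * i * r ∧
      x = 4 + 2 * r - 3 * i * r ∧ y = 2 - 3 * i - 2 * r - 3 * i * r ∧
      b = -(4 * i) - 2 * r - 2 * i * r ∧ c = 2 + 2 * i + 2 * r - 2 * i * r ∧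
      d = -4 - 2 * i - 4 * r + 2 * i * r := by
  have hr0 : r ≠ 0 := by
    rintro rfl
    simp at hr
  have hden : (2 * r ^ 2 + (1 - r) * i) * (2 * r ^ 2 - (1 - r) * i) = r := by
    clear * - hr hi
    grind
  have hden0 : 2 * r ^ 2 + (1 - r) * i ≠ 0 := left_ne_zero_of_mul (hden ▸ hr0)
  have h22 : (2 : F) * 2⁻¹ = 1 := mul_inv_cancel₀ h2
  have ha' : a = 4 * i + 4 * r + 2 * i * r := by
    rw [ha, mul_inv_eq_iff_eq_mul₀ hden0]
    clear * - hr hi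
    grind
  have hainv : a⁻¹ = 2⁻¹ * (2 * r ^ 2 + (1 - r) * i) := by
    rw [ha, mul_inv, inv_inv]
  have halpha' : alpha ^ 2 * (1 + r ^ 2) = 1 := by
    rw [halpha]
    refine inv_mul_cancel₀ fun h ↦ hr0 ?_
    linear_combination hr - h
  obtain ⟨s, hs, hs'⟩ : ∃ s, s ^ 2 = 1 ∧ alpha = s * i * r := by
    refine ⟨-alpha * i * r ^ 2, ?_, ?_⟩ <;> clear * - hr hi halpha' <;> grind
  rw [hainv] at hb hc
  generalize (2 : F)⁻¹ = t at *
  have hlam' : lam = 2 * s + 2 * s * r - 2 * s * i * r := by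
    clear * - hr hi hlam hs'
    grind
  have hlam2 : lam ^ 2 = 4 + 8 * i + 8 * r := by
    clear * - hr hi hs hlam'
    grind
  have hlam2' : t * lam ^ 2 = 2 + 4 * i + 4 * r := by
    linear_combination t * hlam2 + (2 + 4 * i + 4 * r) * h22
  have hx' : x = 4 + 2 * r - 3 * i * r := by
    clear * - hr hi hx ha' h22
    grind
  refine ⟨s, hs, hs', hlam', ?_, ?_, ?_, ?_, ha', hx', ?_, ?_, ?_, ?_⟩
  · clear * - hi heps hlam'
    grind
  · rw [hbeta]
    linear_combination -i * hlam2' - 4 * hi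
  · linear_combination hgamma + hlam2'
  · linear_combination hdelta - hlam2'
  · clear * - hr hy hx'
    grind
  · clear * - hr hi hb hx' h22
    grind
  · clear * - hr hi hc hx' h22
    grind
  · clear * - hr hd ha'
    grind

theorem stmt_19 (p : ℕ) [Fact p.Prime] (hp3 : p % 3 = 1) (hp8 : p % 8 = 5)
    (rho iota alpha lam eps beta gamma delta mu a x y b c d : ZMod p)
    (hrho : orderOf rho = 3)
    (hiota : iota ^ 2 = -1)
    (halpha : alpha ^ 2 = (1 + rho ^ 2)⁻¹)
    (hlam : lam = alpha * (iota + 1) * (-1 + rho - iota * rho ^ 2))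
    (heps : eps = -iota * lam)
    (hbeta : beta = -2⁻¹ * lam ^ 2 * iota)
    (hgamma : gamma = 2⁻¹ * lam ^ 2 - 1)
    (hdelta : delta = -1 - 2⁻¹ * lam ^ 2)
    (hmu : mu = 1 - rho)
    (ha : a = 2 * (2 * rho ^ 2 + (1 - rho) * iota)⁻¹)
    (hx : x = -2⁻¹ * a * rho * (1 - rho))
    (hy : y = -x * rho)
    (hb : b = a⁻¹ * (rho ^ 2 + x ^ 2))
    (hc : c = a⁻¹ * (1 + x ^ 2 * rho))
    (hd : d = a * rho)
    (u1 u2 u3 u4 tu ru : GL (Fin 3 ⊕ Fin 3) (ZMod p))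
    (hu1 : (u1 : Matrix (Fin 3 ⊕ Fin 3) (Fin 3 ⊕ Fin 3) (ZMod p)) =
      fromBlocks 0 !![0, alpha, -alpha * rho; alpha, rho, 1; -alpha * rho, 1, rho ^ 2]
        !![0, alpha, -alpha * rho; alpha, rho, 1; -alpha * rho, 1, rho ^ 2] 0)
    (hu2 : (u2 : Matrix (Fin 3 ⊕ Fin 3) (Fin 3 ⊕ Fin 3) (ZMod p)) =
      fromBlocks (diagonal ![(1 : ZMod p), -1, -1]) 0 0 (diagonal ![(1 : ZMod p), -1, -1]))
    (hu3 : (u3 : Matrix (Fin 3 ⊕ Fin 3) (Fin 3 ⊕ Fin 3) (ZMod p)) =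
      fromBlocks !![1, lam, eps; lam, gamma, beta; eps, beta, delta] 0 0
        !![1, lam, eps; lam, gamma, beta; eps, beta, delta])
    (hu4 : (u4 : Matrix (Fin 3 ⊕ Fin 3) (Fin 3 ⊕ Fin 3) (ZMod p)) =
      fromBlocks 0 !![-rho, 0, 0; 0, 0, rho; 0, rho, -mu * rho ^ 2]
        !![-rho ^ 2, 0, 0; 0, mu, rho ^ 2; 0, rho ^ 2, 0] 0)
    (htu : (tu : Matrix (Fin 3 ⊕ Fin 3) (Fin 3 ⊕ Fin 3) (ZMod p)) = fromBlocks 0 1 1 0)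
    (hru : (ru : Matrix (Fin 3 ⊕ Fin 3) (Fin 3 ⊕ Fin 3) (ZMod p)) =
      fromBlocks 0 !![rho, 0, 0; 0, a, x; 0, x, b] !![rho ^ 2, 0, 0; 0, c, y; 0, y, d] 0)
    (G : Subgroup (GL (Fin 3 ⊕ Fin 3) (ZMod p)))
    (hG : G = Subgroup.closure
      ({g : GL (Fin 3 ⊕ Fin 3) (ZMod p) | ∃ A : Matrix (Fin 3) (Fin 3) (ZMod p),
          A.det = 1 ∧ (g : Matrix (Fin 3 ⊕ Fin 3) (Fin 3 ⊕ Fin 3) (ZMod p)) =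
            fromBlocks A 0 0 (Aᵀ)⁻¹} ∪ {tu})) :
    Subgroup.closure {u1, u2, u3, u4} = G ∧
    Subgroup.closure {u2, u3} = Subgroup.closure {u1, u2, u3} ⊓ Subgroup.closure {u2, u3, u4} ∧
    Subgroup.closure {u2, u3} =
      (G ⊓ Subgroup.centralizer {tu}) ⊓ (G ⊓ Subgroup.centralizer {ru}) := by
  have h30 : (2 : ZMod p) * 15 ≠ 0 := by
    have : ((30 : ℕ) : ZMod p) ≠ 0 := by
      rw [Ne, ZMod.natCast_eq_zero_iff]
      exact not_dvd_thirty hp3 hp8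
    intro h
    apply this
    push_cast
    linear_combination h
  have h2 := left_ne_zero_of_mul h30
  have h15 := right_ne_zero_of_mul h30
  have h3 : (3 : ZMod p) ≠ 0 := by
    intro h
    exact h15 (by linear_combination 5 * h)
  have hr := sq_add_self_add_one_eq_zero_of_orderOf hrho
  obtain ⟨s, hs, rfl, hlam', heps', hbeta', hgamma', hdelta', ha', hx', hy', hb', hc', hd'⟩ :=
    exists_parameters h2 hr hiota halpha hlam heps hbeta hgamma hdelta ha hx hy hb hc hd
  have hrho2 : rho ^ 2 = -1 - rho := by linear_combination hr
  have eT : diagonal ![(1 : ZMod p), -1, -1] = invT (ZMod p) := by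
    ext i j
    fin_cases i <;> fin_cases j <;> simp [invT]
  have eB : !![1, lam, eps; lam, gamma, beta; eps, beta, delta] = invB rho iota s := by
    rw [hlam', heps', hgamma', hbeta', hdelta', invB]
  have eA : !![0, s * iota * rho, -(s * iota * rho) * rho; s * iota * rho, rho, 1;
      -(s * iota * rho) * rho, 1, rho ^ 2] = invA rho iota s := by
    rw [hrho2, invA,
      show -(s * iota * rho) * rho = s * iota + s * iota * rho by
        linear_combination -s * iota * hr]
  have eC : !![-rho, 0, 0; 0, 0, rho; 0, rho, -mu * rho ^ 2] = matC rho := by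
    rw [matC, show -mu * rho ^ 2 = 2 + rho by
      rw [hmu]
      linear_combination (rho - 2) * hr]
  have eD : !![-rho ^ 2, 0, 0; 0, mu, rho ^ 2; 0, rho ^ 2, 0] = matD rho := by
    rw [matD, hrho2, hmu, show -(-1 - rho) = 1 + rho by ring]
  have eR : !![rho, 0, 0; 0, a, x; 0, x, b] = matR rho iota := by
    rw [ha', hx', hb', matR]
  have eR' : !![rho ^ 2, 0, 0; 0, c, y; 0, y, d] = matR' rho iota := by
    rw [hrho2, hc', hy', hd', matR']
  rw [eA] at hu1
  rw [eT] at hu2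
  rw [eB] at hu3
  rw [eC, eD] at hu4
  rw [eR, eR'] at hru
  have hu1' := eq_hyp_mul htu hu1 (det_invA hr hiota hs) (invA_mul_transpose hr hiota hs)
  have hu2' := eq_hyp hu2 det_invT invT_mul_transpose
  have hu3' := eq_hyp hu3 (det_invB hr hiota) (invB_mul_transpose hr hiota hs)
  have hu4' := eq_hyp_mul htu hu4 (det_matC hr) (matC_mul_matD hr)
  have hru' := eq_hyp_mul htu hru (det_matR hr hiota) (matR_mul_matR' hr hiota)
  have cT := contra_mkSL_eq (F := ZMod p) det_invT invT_mul_transpose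
  have cB := contra_mkSL_eq (det_invB hr hiota) (invB_mul_transpose hr hiota hs)
  have cA := contra_mkSL_eq (det_invA hr hiota hs) (invA_mul_transpose hr hiota hs)
  rw [← range_hyp] at hG
  have hgen := closure_eq_closure_range_hyp h2 h15 hr hiota hs rfl rfl rfl rfl cT cB htu hu1' hu2'
    hu3' hu4'
  have t1 : tu * u1 = u1 * tu := by
    rw [hu1', ← mul_assoc, (swap_mul_hyp_eq_iff htu _).2 cA]
  have t2 : tu * u2 = u2 * tu := hu2' ▸ (swap_mul_hyp_eq_iff htu _).2 cT
  have t3 : tu * u3 = u3 * tu := hu3' ▸ (swap_mul_hyp_eq_iff htu _).2 cB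
  have r2 : ru * u2 = u2 * ru := by
    rw [hru', hu2']
    exact hyp_mul_swap_mul_hyp htu cT (eq_of_coe_eq (matR_mul_invT _ _))
  have r3 : ru * u3 = u3 * ru := by
    rw [hru', hu3']
    exact hyp_mul_swap_mul_hyp htu cB (eq_of_coe_eq (matR_mul_invB hr hiota))
  have r4 : ru * u4 = u4 * ru := by
    apply Units.ext
    rw [Units.val_mul, Units.val_mul, hru, hu4, fromBlocks_multiply, fromBlocks_multiply]
    simp [matC_mul_matR' hr, matD_mul_matR hr]
  have hle1 : Subgroup.closure {u2, u3} ≤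
      Subgroup.closure {u1, u2, u3} ⊓ Subgroup.closure {u2, u3, u4} :=
    le_inf (Subgroup.closure_mono (by grind)) (Subgroup.closure_mono (by grind))
  have hle2 : Subgroup.closure {u1, u2, u3} ⊓ Subgroup.closure {u2, u3, u4} ≤
      (G ⊓ Subgroup.centralizer {tu}) ⊓ (G ⊓ Subgroup.centralizer {ru}) := by
    refine inf_le_inf (le_inf ?_ ?_) (le_inf ?_ ?_)
    · rw [hG, ← hgen]
      exact Subgroup.closure_mono (by grind)
    · rw [Subgroup.closure_le]
      rintro g (rfl | rfl | rfl) <;> simpa [Subgroup.mem_centralizer_singleton_iff, eq_comm]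
    · rw [hG, ← hgen]
      exact Subgroup.closure_mono (by grind)
    · rw [Subgroup.closure_le]
      rintro g (rfl | rfl | rfl) <;> simpa [Subgroup.mem_centralizer_singleton_iff, eq_comm]
  have hle3 : (G ⊓ Subgroup.centralizer {tu}) ⊓ (G ⊓ Subgroup.centralizer {ru}) ≤
      Subgroup.closure {u2, u3} := by
    rintro g ⟨⟨hg, hgt⟩, -, hgr⟩
    rw [hG] at hg
    exact mem_closure_of_mem_centralizer h2 h3 hr hiota hs rfl rfl htu hu2' hu3' hru' hg
      (Subgroup.mem_centralizer_iff.1 hgt tu rfl) (Subgroup.mem_centralizer_iff.1 hgr ru rfl)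
  exact ⟨hgen.trans hG.symm, le_antisymm hle1 (hle2.trans hle3),
    le_antisymm (hle1.trans hle2) hle3⟩
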